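/- arXiv:1902.05679 — 6 statements merged into one kernel-verified Lean document; each statement's English description precedes it below -/
import Mathlib

section
/- Let E be a real inner product space, let n ≥ 1 be an integer, let f_1, …, f_n : E → ℝ be differentiable functions with f := (1/n)∑_{i=1}^n f_i, and let w, w' ∈ E and v' ∈ E be given. For each i ∈ {1, …, n} define the single-sample SARAH update v_i := v' + ∇f_i(w) − ∇f_i(w'). Then: (i) (1/n)∑_{i=1}^n v_i = v' + ∇f(w) − ∇f(w') (so the estimator is biased unless v' = ∇f(w')), and (ii) (1/n)∑_{i=1}^n ‖v_i − ∇f(w)‖² = ‖v' − ∇f(w')‖² + (1/n)∑_{i=1}^n ‖v_i − v'‖² − ‖∇f(w) − ∇f(w')‖². -/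
/-- Expanding the mean square of a translated finite family `d` around its mean. -/
theorem average_norm_add_sq {ι E : Type*} [Fintype ι] [Nonempty ι] [NormedAddCommGroup E]
    [InnerProductSpace ℝ E] (x : E) (d : ι → E) :
    (Fintype.card ι : ℝ)⁻¹ * ∑ i, ‖x + d i‖ ^ 2 =
      ‖x + (Fintype.card ι : ℝ)⁻¹ • ∑ i, d i‖ ^ 2 +
        (Fintype.card ι : ℝ)⁻¹ * ∑ i, ‖d i‖ ^ 2 -
        ‖(Fintype.card ι : ℝ)⁻¹ • ∑ i, d i‖ ^ 2 := by
  have hn : (Fintype.card ι : ℝ) ≠ 0 := Nat.cast_ne_zero.2 Fintype.card_ne_zero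
  simp only [norm_add_sq_real, Finset.sum_add_distrib, ← Finset.mul_sum, ← inner_sum,
    real_inner_smul_right, Finset.sum_const, Finset.card_univ, nsmul_eq_mul]
  field_simp
  ring

/-- Mean and second-moment identities of the single-sample SARAH estimator
`v_i := v' + ∇f_i(w) − ∇f_i(w')`, written as averages over the `n` samples,
where `∇f = (1/n)∑ ∇f_i`:
(i) `(1/n)∑ v_i = v' + ∇f(w) − ∇f(w')`;
(ii) `(1/n)∑‖v_i − ∇f(w)‖² = ‖v' − ∇f(w')‖² + (1/n)∑‖v_i − v'‖² − ‖∇f(w) − ∇f(w')‖²`. -/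
theorem stmt_4 {E : Type*} [NormedAddCommGroup E] [InnerProductSpace ℝ E]
    [CompleteSpace E] (n : ℕ) (hn : 1 ≤ n) (f : Fin n → E → ℝ)
    (hf : ∀ i, Differentiable ℝ (f i)) (w w' v' : E)
    (v : Fin n → E)
    (hv : ∀ i, v i = v' + gradient (f i) w - gradient (f i) w') :
    ((n : ℝ)⁻¹ • ∑ i, v i =
        v' + (n : ℝ)⁻¹ • (∑ i, gradient (f i) w) -
          (n : ℝ)⁻¹ • (∑ i, gradient (f i) w')) ∧
    ((1 / (n : ℝ)) * ∑ i, ‖v i - (n : ℝ)⁻¹ • (∑ j, gradient (f j) w)‖ ^ 2 =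
        ‖v' - (n : ℝ)⁻¹ • (∑ j, gradient (f j) w')‖ ^ 2 +
          (1 / (n : ℝ)) * ∑ i, ‖v i - v'‖ ^ 2 -
          ‖(n : ℝ)⁻¹ • (∑ j, gradient (f j) w) -
              (n : ℝ)⁻¹ • (∑ j, gradient (f j) w')‖ ^ 2) := by
  have hn0 : (n : ℝ) ≠ 0 := Nat.cast_ne_zero.2 (by lia)
  have : Nonempty (Fin n) := ⟨⟨0, hn⟩⟩
  constructor
  · simp only [hv, Finset.sum_sub_distrib, Finset.sum_add_distrib, Finset.sum_const,
      Finset.card_univ, Fintype.card_fin, smul_sub, smul_add, ← Nat.cast_smul_eq_nsmul ℝ,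
      inv_smul_smul₀ hn0]
  · set A := (n : ℝ)⁻¹ • ∑ j, gradient (f j) w
    set B := (n : ℝ)⁻¹ • ∑ j, gradient (f j) w'
    have hmean : (n : ℝ)⁻¹ • ∑ i, (gradient (f i) w - gradient (f i) w') = A - B := by
      rw [Finset.sum_sub_distrib, smul_sub]
    have hsub (i : Fin n) : v i - v' = gradient (f i) w - gradient (f i) w' := by
      rw [hv]; abel
    have hshift (i : Fin n) :
        v i - A = (v' - A) + (gradient (f i) w - gradient (f i) w') := by
      rw [hv]; abel
    have key := average_norm_add_sq (v' - A)
      fun i => gradient (f i) w - gradient (f i) w'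
    rw [Fintype.card_fin, hmean, sub_add_sub_cancel] at key
    simpa only [one_div, hsub, hshift] using key
end

section
/- Let E be a real inner product space, let n ≥ 2 and 1 ≤ b ≤ n be integers, let a_1, …, a_n ∈ E, and set ā := (1/n)∑_{i=1}^n a_i. Then the average over all subsets B ⊆ {1, …, n} of cardinality b satisfies: (1/C(n,b))·∑_{B, |B|=b} ‖(1/b)∑_{i∈B} a_i‖² = (n(b−1)/(b(n−1)))·‖ā‖² + ((n−b)/(b(n−1)))·(1/n)∑_{i=1}^n ‖a_i‖², where C(n,b) is the binomial coefficient. -/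
/-- The number of `b`-element subsets of a finite type containing a given element `i`,
multiplied by the size of the type, is `b` times the number of all `b`-element subsets. -/
lemma card_mul_card_filter_mem_powersetCard {ι : Type*} [Fintype ι] [DecidableEq ι]
    (b : ℕ) (i : ι) :
    Fintype.card ι * Finset.card {B ∈ Finset.powersetCard b (Finset.univ : Finset ι) | i ∈ B} =
      b * (Fintype.card ι).choose b := by
  have hpos : 0 < Fintype.card ι := Fintype.card_pos_iff.mpr ⟨i⟩
  rcases Nat.eq_zero_or_pos b with rfl | hb
  · simp [Finset.filter_singleton]
  have h := Finset.card_filter_powersetCard_subset {i} Finset.univ b (by simp) (by simpa)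
  simp only [Finset.singleton_subset_iff, Finset.card_singleton, Finset.card_univ] at h
  rw [h]
  obtain ⟨m, hm⟩ := Nat.exists_eq_add_of_lt hpos
  obtain ⟨c, rfl⟩ := Nat.exists_eq_add_of_lt hb
  rw [hm]
  simpa [mul_comm] using Nat.add_one_mul_choose_eq m c

/-- The number of `b`-element subsets of a finite type of size `n` containing two given distinct
elements, multiplied by `n (n - 1)`, is `b (b - 1)` times the number of all `b`-element subsets. -/
lemma card_mul_card_filter_mem_mem_powersetCard {ι : Type*} [Fintype ι] [DecidableEq ι]
    (b : ℕ) {i j : ι} (hij : i ≠ j) :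
    Fintype.card ι * (Fintype.card ι - 1) *
        Finset.card {B ∈ Finset.powersetCard b (Finset.univ : Finset ι) | i ∈ B ∧ j ∈ B} =
      b * (b - 1) * (Fintype.card ι).choose b := by
  have hcard : 2 ≤ Fintype.card ι := by
    simpa [Finset.card_pair hij] using Finset.card_le_univ {i, j}
  by_cases hb : 2 ≤ b
  · have h := Finset.card_filter_powersetCard_subset {i, j} Finset.univ b (by simp)
      (by rwa [Finset.card_pair hij])
    simp only [Finset.insert_subset_iff, Finset.singleton_subset_iff, Finset.card_pair hij,
      Finset.card_univ] at h
    rw [h]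
    obtain ⟨m, hm⟩ := Nat.exists_eq_add_of_le' hcard
    obtain ⟨c, rfl⟩ := Nat.exists_eq_add_of_le' hb
    rw [hm]
    have h1 := Nat.add_one_mul_choose_eq (m + 1) (c + 1)
    have h2 := Nat.add_one_mul_choose_eq m c
    simp only [Nat.add_sub_cancel, show m + 2 - 1 = m + 1 from rfl,
      show c + 2 - 1 = c + 1 from rfl]
    linear_combination (m + 2) * h2 + (c + 1) * h1
  · have h :
        Finset.card {B ∈ Finset.powersetCard b (Finset.univ : Finset ι) | i ∈ B ∧ j ∈ B} = 0 := by
      rw [Finset.card_eq_zero, Finset.filter_eq_empty_iff]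
      rintro B hB ⟨hi, hj⟩
      have hle : ({i, j} : Finset ι).card ≤ B.card :=
        Finset.card_le_card (Finset.insert_subset hi (Finset.singleton_subset_iff.mpr hj))
      rw [Finset.card_pair hij, (Finset.mem_powersetCard.mp hB).2] at hle
      exact hb hle
    have hbb : b * (b - 1) = 0 := by
      interval_cases b <;> simp at hb ⊢
    rw [h, hbb, mul_zero, zero_mul]

open scoped RealInnerProductSpace in
/-- Expansion of the sum of squared norms of subset sums over a family of finite sets: each
pair `(i, j)` is weighted by the number of members of the family containing both. -/
lemma sum_norm_sq_sum_eq_sum_card_mul_inner {ι E : Type*} [Fintype ι] [DecidableEq ι]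
    [NormedAddCommGroup E] [InnerProductSpace ℝ E] (S : Finset (Finset ι)) (a : ι → E) :
    ∑ B ∈ S, ‖∑ i ∈ B, a i‖ ^ 2 =
      ∑ i, ∑ j, (Finset.card {B ∈ S | i ∈ B ∧ j ∈ B} : ℝ) * ⟪a i, a j⟫ := by
  have h (B : Finset ι) : ‖∑ i ∈ B, a i‖ ^ 2 =
      ∑ i, ∑ j, if i ∈ B ∧ j ∈ B then ⟪a i, a j⟫ else 0 := by
    rw [← real_inner_self_eq_norm_sq, sum_inner]
    simp_rw [inner_sum, ite_and, Finset.sum_ite_irrel, Finset.sum_const_zero,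
      Finset.sum_ite_mem, Finset.univ_inter]
  simp_rw [h]
  rw [Finset.sum_comm]
  refine Finset.sum_congr rfl fun i _ => ?_
  rw [Finset.sum_comm]
  refine Finset.sum_congr rfl fun j _ => ?_
  rw [← Finset.sum_filter, Finset.sum_const, nsmul_eq_mul]

/-- Second-moment identity for a mini-batch average under uniform sampling
without replacement: averaging `‖(1/b)∑_{i∈B} a_i‖²` over all `b`-element
subsets `B` of `{1,…,n}` gives
`(n(b−1)/(b(n−1)))‖ā‖² + ((n−b)/(b(n−1)))·(1/n)∑‖a_i‖²`. -/
theorem stmt_5 {E : Type*} [NormedAddCommGroup E] [InnerProductSpace ℝ E]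
    (n b : ℕ) (hn : 2 ≤ n) (hb1 : 1 ≤ b) (hbn : b ≤ n) (a : Fin n → E) :
    (1 / (n.choose b : ℝ)) *
        ∑ B ∈ Finset.powersetCard b (Finset.univ : Finset (Fin n)),
          ‖(b : ℝ)⁻¹ • ∑ i ∈ B, a i‖ ^ 2 =
      ((n : ℝ) * ((b : ℝ) - 1) / ((b : ℝ) * ((n : ℝ) - 1))) *
          ‖(n : ℝ)⁻¹ • ∑ i, a i‖ ^ 2 +
        (((n : ℝ) - (b : ℝ)) / ((b : ℝ) * ((n : ℝ) - 1))) *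
          ((1 / (n : ℝ)) * ∑ i, ‖a i‖ ^ 2) := by
  have hn0 : (n : ℝ) ≠ 0 := by positivity
  have hb0 : (b : ℝ) ≠ 0 := by positivity
  have hn1 : (n : ℝ) - 1 ≠ 0 := by
    have : (2 : ℝ) ≤ n := by exact_mod_cast hn
    linarith
  have hN : (n.choose b : ℝ) ≠ 0 := by exact_mod_cast (Nat.choose_pos hbn).ne'
  have hdiag (i : Fin n) :
      (Finset.card {B ∈ Finset.powersetCard b Finset.univ | i ∈ B} : ℝ) =
        b * n.choose b / n := by
    have h := card_mul_card_filter_mem_powersetCard b i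
    rw [Fintype.card_fin] at h
    rw [eq_div_iff hn0, mul_comm]
    exact_mod_cast h
  have hoff {i j : Fin n} (hij : i ≠ j) :
      (Finset.card {B ∈ Finset.powersetCard b Finset.univ | i ∈ B ∧ j ∈ B} : ℝ) =
        b * (b - 1) * n.choose b / (n * (n - 1)) := by
    have h := card_mul_card_filter_mem_mem_powersetCard b hij
    rw [Fintype.card_fin] at h
    rw [eq_div_iff (mul_ne_zero hn0 hn1), mul_comm, ← Nat.cast_pred (by lia : 0 < n),
      ← Nat.cast_pred (by lia : 0 < b)]
    exact_mod_cast h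
  have hterm (i j : Fin n) :
      (Finset.card {B ∈ Finset.powersetCard b Finset.univ | i ∈ B ∧ j ∈ B} : ℝ) *
          inner ℝ (a i) (a j) =
        b * (b - 1) * n.choose b / (n * (n - 1)) * inner ℝ (a i) (a j) +
          if i = j then (b * n.choose b / n - b * (b - 1) * n.choose b / (n * (n - 1))) *
            ‖a i‖ ^ 2 else 0 := by
    split_ifs with hij
    · subst hij
      simp only [and_self, hdiag, real_inner_self_eq_norm_sq]
      ring
    · rw [hoff hij, add_zero]
  have hsum : ∑ i, ∑ j, inner ℝ (a i) (a j) = ‖∑ i, a i‖ ^ 2 := by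
    simp_rw [← real_inner_self_eq_norm_sq, sum_inner, inner_sum]
  simp_rw [norm_smul, mul_pow, norm_inv, Real.norm_natCast]
  rw [← Finset.mul_sum, sum_norm_sq_sum_eq_sum_card_mul_inner]
  simp_rw [hterm, Finset.sum_add_distrib, ← Finset.mul_sum, hsum, Finset.sum_ite_eq,
    Finset.mem_univ, if_true, ← Finset.mul_sum]
  field_simp
  ring
end

section
/- Let E be a real inner product space, let ψ : E → ℝ be convex, let η > 0, γ ∈ (0,1], and let w, v ∈ E. Suppose ŵ ∈ E is a proximal point of ψ at w − ηv with parameter η, i.e., ŵ minimizes z ↦ ψ(z) + (1/(2η))‖z − (w − ηv)‖² over E, and set w⁺ := (1−γ)w + γŵ. Then ψ(w⁺) ≤ ψ(w) + γ·⟨v, w − ŵ⟩ − (γ/η)·‖ŵ − w‖². -/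
open RealInnerProductSpace

/-- `p` is a proximal point of `ψ` at `u` with parameter `η`, i.e. `p`
minimizes `z ↦ ψ(z) + (1/(2η))‖z − u‖²`. -/
def IsProxPt {E : Type*} [NormedAddCommGroup E] [InnerProductSpace ℝ E]
    (ψ : E → ℝ) (η : ℝ) (u p : E) : Prop :=
  ∀ z : E, ψ p + 1 / (2 * η) * ‖p - u‖ ^ 2 ≤ ψ z + 1 / (2 * η) * ‖z - u‖ ^ 2

/-- The variational inequality characterizing a proximal point of a convex function. -/
theorem IsProxPt.add_inner_le {E : Type*} [NormedAddCommGroup E] [InnerProductSpace ℝ E]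
    {ψ : E → ℝ} {η : ℝ} {u p : E} (hψ : ConvexOn ℝ Set.univ ψ) (hη : 0 < η)
    (hp : IsProxPt ψ η u p) (z : E) :
    ψ p + 1 / η * ⟪p - u, p - z⟫ ≤ ψ z := by
  have key : ∀ t : ℝ, 0 < t → t ≤ 1 →
      ψ p + 1 / η * ⟪p - u, p - z⟫ - ψ z ≤ t * (1 / (2 * η) * ‖p - z‖ ^ 2) := by
    intro t ht0 ht1
    have hmin := hp ((1 - t) • p + t • z)
    have hconv := hψ.2 (Set.mem_univ p) (Set.mem_univ z) (sub_nonneg.2 ht1) ht0.le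
      (sub_add_cancel 1 t)
    have hsub : (1 - t) • p + t • z - u = (p - u) - t • (p - z) := by module
    rw [hsub, norm_sub_sq_real (p - u) (t • (p - z)), real_inner_smul_right,
      norm_smul, Real.norm_of_nonneg ht0.le] at hmin
    simp only [smul_eq_mul] at hconv
    have hhalf : 1 / η = 2 * (1 / (2 * η)) := by field_simp
    rw [hhalf]
    refine le_of_mul_le_mul_left ?_ ht0
    linear_combination hmin + hconv
  have hB : 0 ≤ 1 / (2 * η) * ‖p - z‖ ^ 2 := by positivity
  generalize 1 / (2 * η) * ‖p - z‖ ^ 2 = B at key hB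
  by_contra! hlt
  have hA : 0 < ψ p + 1 / η * ⟪p - u, p - z⟫ - ψ z := sub_pos.2 hlt
  generalize ψ p + 1 / η * ⟪p - u, p - z⟫ - ψ z = A at key hA
  have hle := key (A / (A + B)) (by positivity) (div_le_one_of_le₀ (by linarith) (by positivity))
  rw [div_mul_eq_mul_div, le_div_iff₀ (by positivity)] at hle
  nlinarith

/-- Key estimate on the regularizer along the averaged proximal step: if `wHat`
is a proximal point of the convex function `ψ` at `w − ηv` and
`w⁺ := (1−γ)w + γ·wHat`, then
`ψ(w⁺) ≤ ψ(w) + γ⟨v, w − wHat⟩ − (γ/η)‖wHat − w‖²`. -/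
theorem stmt_9 {E : Type*} [NormedAddCommGroup E] [InnerProductSpace ℝ E]
    (ψ : E → ℝ) (hψ : ConvexOn ℝ Set.univ ψ)
    (η γ : ℝ) (hη : 0 < η) (hγ0 : 0 < γ) (hγ1 : γ ≤ 1)
    (w v wHat : E) (hw : IsProxPt ψ η (w - η • v) wHat) :
    ψ ((1 - γ) • w + γ • wHat) ≤
      ψ w + γ * ⟪v, w - wHat⟫ - γ / η * ‖wHat - w‖ ^ 2 := by
  have hprox := hw.add_inner_le hψ hη w
  have hconv := hψ.2 (Set.mem_univ w) (Set.mem_univ wHat) (sub_nonneg.2 hγ1) hγ0.le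
    (sub_add_cancel 1 γ)
  simp only [smul_eq_mul] at hconv
  have hinner : 1 / η * ⟪wHat - (w - η • v), wHat - w⟫ =
      1 / η * ‖wHat - w‖ ^ 2 - ⟪v, w - wHat⟫ := by
    have hsub : wHat - (w - η • v) = (wHat - w) + η • v := by module
    rw [hsub, inner_add_left, real_inner_smul_left, real_inner_self_eq_norm_sq,
      ← neg_sub w wHat, inner_neg_right]
    field_simp
    ring
  rw [hinner] at hprox
  linear_combination hconv + γ * hprox
end

section
/- Let E be a real inner product space, let f : E → ℝ be differentiable with L-Lipschitz gradient for some L > 0, let ψ : E → ℝ be convex, and set F := f + ψ. Let η > 0, γ ∈ (0,1], c > 0, r > 0, s > 0, and w, v ∈ E. Suppose ŵ ∈ E is a proximal point of ψ at w − ηv with parameter η, suppose p ∈ E is a proximal point of ψ at w − η∇f(w) with parameter η, define the gradient mapping value G_η(w) := (1/η)(w − p), and set w⁺ := (1−γ)w + γŵ. Then F(w⁺) ≤ F(w) − (s·η²/2)·‖G_η(w)‖² + (1/2)·(γ/c + (1+r)·s·η²)·‖∇f(w) − v‖² − (1/2)·(2γ/η − Lγ² − γc − s·(1 + 1/r))·‖ŵ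 − w‖² − (γ/(2c))·‖∇f(w) − v − c·(ŵ − w)‖². -/
open scoped RealInnerProductSpace

/-- The variational inequality characterizing a proximal point of a convex function. -/
theorem IsProxPt.inner_le {E : Type*} [NormedAddCommGroup E] [InnerProductSpace ℝ E]
    {ψ : E → ℝ} (hψ : ConvexOn ℝ Set.univ ψ) {η : ℝ} (hη : 0 < η) {u p : E}
    (hp : IsProxPt ψ η u p) (z : E) : ψ p + 1 / η * ⟪u - p, z - p⟫ ≤ ψ z := by
  set a := ψ p + 1 / η * ⟪u - p, z - p⟫ - ψ z with ha
  set b := 1 / (2 * η) * ‖z - p‖ ^ 2 with hb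
  have key : ∀ t : ℝ, 0 < t → t ≤ 1 → a ≤ t * b := by
    intro t ht0 ht1
    have hmin := hp ((1 - t) • p + t • z)
    have hconv := hψ.2 (Set.mem_univ p) (Set.mem_univ z) (sub_nonneg.2 ht1) ht0.le
      (sub_add_cancel 1 t)
    simp only [smul_eq_mul] at hconv
    have hnorm : ‖(1 - t) • p + t • z - u‖ ^ 2 =
        ‖p - u‖ ^ 2 - 2 * t * ⟪u - p, z - p⟫ + t ^ 2 * ‖z - p‖ ^ 2 := by
      have hsplit : (1 - t) • p + t • z - u = t • (z - p) - (u - p) := by module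
      rw [hsplit, norm_sub_sq_real, norm_smul, inner_smul_left, mul_pow, Real.norm_eq_abs,
        sq_abs, norm_sub_rev p u, real_inner_comm]
      simp only [conj_trivial]
      ring
    rw [hnorm] at hmin
    have hη' : 1 / (2 * η) = 1 / η / 2 := by field_simp
    rw [hη'] at hmin hb
    refine le_of_mul_le_mul_left ?_ ht0
    rw [ha, hb]
    linarith
  have hb0 : 0 ≤ b := by positivity
  by_contra! hlt
  have ha0 : 0 < a := by linarith
  have hab : 0 < a + b := by linarith
  have h := key (a / (a + b)) (by positivity) ((div_le_one hab).2 (by linarith))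
  rw [div_mul_eq_mul_div, le_div_iff₀ hab] at h
  nlinarith

/-- The proximal operator of a convex function is nonexpansive. -/
theorem IsProxPt.norm_sub_le {E : Type*} [NormedAddCommGroup E] [InnerProductSpace ℝ E]
    {ψ : E → ℝ} (hψ : ConvexOn ℝ Set.univ ψ) {η : ℝ} (hη : 0 < η) {u u' p p' : E}
    (hp : IsProxPt ψ η u p) (hp' : IsProxPt ψ η u' p') : ‖p - p'‖ ≤ ‖u - u'‖ := by
  have h := hp.inner_le hψ hη p'
  have h' := hp'.inner_le hψ hη p
  have hsum : 1 / η * (⟪u - p, p' - p⟫ + ⟪u' - p', p - p'⟫) ≤ 0 := by linarith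
  have hsum' : ⟪u - p, p' - p⟫ + ⟪u' - p', p - p'⟫ ≤ 0 :=
    nonpos_of_mul_nonpos_right hsum (by positivity)
  have heq : ⟪u - p, p' - p⟫ + ⟪u' - p', p - p'⟫ = ‖p - p'‖ ^ 2 - ⟪u - u', p - p'⟫ := by
    rw [← real_inner_self_eq_norm_sq, ← neg_sub p p', inner_neg_right, ← inner_neg_left,
      ← inner_add_left, ← inner_sub_left]
    congr 1
    abel
  have hcs := real_inner_le_norm (u - u') (p - p')
  by_contra! hlt
  nlinarith [norm_nonneg (u - u')]

/-- The descent lemma for a function with `L`-Lipschitz gradient. -/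
theorem le_add_inner_gradient_add_sq {E : Type*} [NormedAddCommGroup E] [InnerProductSpace ℝ E]
    [CompleteSpace E] {f : E → ℝ} (hf : Differentiable ℝ f) {L : ℝ}
    (hlip : ∀ x y : E, ‖gradient f x - gradient f y‖ ≤ L * ‖x - y‖) (x d : E) :
    f (x + d) ≤ f x + ⟪gradient f x, d⟫ + L / 2 * ‖d‖ ^ 2 := by
  let h : ℝ → ℝ := fun t ↦ f (x + t • d) - t * ⟪gradient f x, d⟫ - t ^ 2 * (L / 2 * ‖d‖ ^ 2)
  have hderiv : ∀ t : ℝ, HasDerivAt h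
      (⟪gradient f (x + t • d), d⟫ - ⟪gradient f x, d⟫ - 2 * t * (L / 2 * ‖d‖ ^ 2)) t := by
    intro t
    have hline : HasDerivAt (fun t : ℝ ↦ x + t • d) d t := by
      simpa using ((hasDerivAt_id t).smul_const d).const_add x
    have hcomp := (hf (x + t • d)).hasGradientAt.hasFDerivAt.comp_hasDerivAt t hline
    rw [InnerProductSpace.toDual_apply_apply] at hcomp
    have hlin := (hasDerivAt_id t).mul_const ⟪gradient f x, d⟫
    have hquad := (hasDerivAt_pow 2 t).mul_const (L / 2 * ‖d‖ ^ 2)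
    exact ((hcomp.sub hlin).sub hquad).congr_deriv (by simp)
  have hanti : AntitoneOn h (Set.Icc 0 1) := by
    refine antitoneOn_of_deriv_nonpos (convex_Icc 0 1)
      (fun t _ ↦ (hderiv t).continuousAt.continuousWithinAt)
      (fun t _ ↦ (hderiv t).differentiableAt.differentiableWithinAt) fun t ht ↦ ?_
    rw [interior_Icc] at ht
    rw [(hderiv t).deriv, ← inner_sub_left]
    have hcs := real_inner_le_norm (gradient f (x + t • d) - gradient f x) d
    have hgrad := hlip (x + t • d) x
    rw [add_sub_cancel_left, norm_smul, Real.norm_of_nonneg ht.1.le] at hgrad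
    nlinarith [mul_le_mul_of_nonneg_right hgrad (norm_nonneg d)]
  have hle := hanti (Set.left_mem_Icc.2 zero_le_one) (Set.right_mem_Icc.2 zero_le_one) zero_le_one
  simp only [h, one_smul, zero_smul, add_zero] at hle
  linarith

/-- Young's inequality for the squared norm of a sum. -/
theorem norm_add_sq_le_mul_add_mul {E : Type*} [SeminormedAddCommGroup E] (x y : E) {r : ℝ}
    (hr : 0 < r) : ‖x + y‖ ^ 2 ≤ (1 + 1 / r) * ‖x‖ ^ 2 + (1 + r) * ‖y‖ ^ 2 := by
  have hsq : ‖x + y‖ ^ 2 ≤ (‖x‖ + ‖y‖) ^ 2 := by gcongr; exact norm_add_le x y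
  have hyoung : 0 ≤ (‖x‖ - r * ‖y‖) ^ 2 / r := by positivity
  have heq : (‖x‖ - r * ‖y‖) ^ 2 / r = 1 / r * ‖x‖ ^ 2 - 2 * ‖x‖ * ‖y‖ + r * ‖y‖ ^ 2 := by
    field_simp
    ring
  linarith

/-- The full one-iteration estimate of ProxSARAH for `F = f + ψ`: with `wHat`
the proximal point of `ψ` at `w − ηv`, `p` the proximal point at `w − η∇f(w)`,
gradient mapping `G_η(w) = (1/η)(w − p)`, and `w⁺ := (1−γ)w + γ·wHat`,
`F(w⁺) ≤ F(w) − (sη²/2)‖G_η(w)‖² + (1/2)(γ/c + (1+r)sη²)‖∇f(w) − v‖²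
  − (1/2)(2γ/η − Lγ² − γc − s(1+1/r))‖wHat − w‖² − (γ/(2c))‖∇f(w) − v − c(wHat − w)‖²`. -/
theorem stmt_12 {E : Type*} [NormedAddCommGroup E] [InnerProductSpace ℝ E]
    [CompleteSpace E] (f : E → ℝ) (hf : Differentiable ℝ f) (L : ℝ) (hL : 0 < L)
    (hlip : ∀ x y : E, ‖gradient f x - gradient f y‖ ≤ L * ‖x - y‖)
    (ψ : E → ℝ) (hψ : ConvexOn ℝ Set.univ ψ)
    (η γ c r s : ℝ) (hη : 0 < η) (hγ0 : 0 < γ) (hγ1 : γ ≤ 1)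
    (hc : 0 < c) (hr : 0 < r) (hs : 0 < s)
    (w v wHat p : E)
    (hw : IsProxPt ψ η (w - η • v) wHat)
    (hp : IsProxPt ψ η (w - η • gradient f w) p) :
    f ((1 - γ) • w + γ • wHat) + ψ ((1 - γ) • w + γ • wHat) ≤
      f w + ψ w - s * η ^ 2 / 2 * ‖(1 / η) • (w - p)‖ ^ 2 +
        1 / 2 * (γ / c + (1 + r) * s * η ^ 2) * ‖gradient f w - v‖ ^ 2 -
        1 / 2 * (2 * γ / η - L * γ ^ 2 - γ * c - s * (1 + 1 / r)) *
          ‖wHat - w‖ ^ 2 -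
        γ / (2 * c) * ‖gradient f w - v - c • (wHat - w)‖ ^ 2 := by
  set g := gradient f w with hg
  have hstep : (1 - γ) • w + γ • wHat = w + γ • (wHat - w) := by module
  have hdescent := le_add_inner_gradient_add_sq hf hlip w (γ • (wHat - w))
  rw [← hstep, ← hg, inner_smul_right, norm_smul, Real.norm_of_nonneg hγ0.le, mul_pow]
    at hdescent
  have hconv := hψ.2 (Set.mem_univ w) (Set.mem_univ wHat) (sub_nonneg.2 hγ1) hγ0.le
    (sub_add_cancel 1 γ)
  simp only [smul_eq_mul] at hconv
  have hprox : ψ wHat + 1 / η * ‖wHat - w‖ ^ 2 + ⟪v, wHat - w⟫ ≤ ψ w := by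
    have h := hw.inner_le hψ hη w
    have hsplit : w - η • v - wHat = -((wHat - w) + η • v) := by abel
    rw [hsplit, ← neg_sub wHat w, inner_neg_neg, inner_add_left, inner_smul_left,
      real_inner_self_eq_norm_sq, conj_trivial, mul_add, ← mul_assoc (1 / η) η,
      one_div_mul_cancel hη.ne', one_mul] at h
    linarith
  have hmap : ‖w - p‖ ^ 2 ≤
      (1 + 1 / r) * ‖wHat - w‖ ^ 2 + (1 + r) * (η ^ 2 * ‖g - v‖ ^ 2) := by
    have hnonexp := hw.norm_sub_le hψ hη hp
    have hshift : w - η • v - (w - η • g) = η • (g - v) := by module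
    rw [hshift, norm_smul, Real.norm_of_nonneg hη.le] at hnonexp
    have h := norm_add_sq_le_mul_add_mul (w - wHat) (wHat - p) hr
    rw [sub_add_sub_cancel, norm_sub_rev w wHat] at h
    rw [← mul_pow]
    exact h.trans (by gcongr)
  have hG : s * η ^ 2 / 2 * ‖(1 / η) • (w - p)‖ ^ 2 = s / 2 * ‖w - p‖ ^ 2 := by
    rw [norm_smul, Real.norm_of_nonneg (by positivity)]
    field_simp
  have hpolar : γ / (2 * c) * ‖g - v - c • (wHat - w)‖ ^ 2 =
      γ / (2 * c) * ‖g - v‖ ^ 2 - γ * (⟪g, wHat - w⟫ - ⟪v, wHat - w⟫) +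
        γ * c / 2 * ‖wHat - w‖ ^ 2 := by
    rw [norm_sub_sq_real, inner_smul_right, norm_smul, Real.norm_of_nonneg hc.le,
      inner_sub_left]
    field_simp
  rw [hG, hpolar]
  have hprox' := mul_le_mul_of_nonneg_left hprox hγ0.le
  have hmap' := mul_le_mul_of_nonneg_left hmap (by positivity : 0 ≤ s / 2)
  have hc' : γ / (2 * c) = γ / c / 2 := by field_simp
  have hη' : 2 * γ / η = 2 * (γ * (1 / η)) := by ring
  rw [hc', hη']
  linarith
end

section
/- Let ν > 0, δ > 0, L > 0 and let m ≥ 1 be an integer. Let γ_0, …, γ_m be defined recursively in backward mode by γ_m := δ/L and γ_t := δ/(L·(1 + ν·L·∑_{j=t+1}^m γ_j)) for t = m−1, …, 0, and set Σ := ∑_{t=0}^m γ_t and S² := ∑_{t=0}^m γ_t². Then ν·L²·Σ² + 2·L·Σ − 2·δ·(m+1) = ν·L²·S². -/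
/-- Tail sums of a sequence satisfying the backward recursion are nonnegative and satisfy the
quadratic identity. -/
theorem backward_stepsize_tail_identity {ν δ L : ℝ} (hν : 0 < ν) (hδ : 0 < δ) (hL : 0 < L)
    {n : ℕ} {γ : ℕ → ℝ}
    (hγ : ∀ t < n, γ t = δ / (L * (1 + ν * L * ∑ j ∈ Finset.Ico (t + 1) n, γ j)))
    (k t : ℕ) (hkt : t + k = n) :
    0 ≤ ∑ j ∈ Finset.Ico t n, γ j ∧
      ν * L ^ 2 * (∑ j ∈ Finset.Ico t n, γ j) ^ 2 + 2 * L * (∑ j ∈ Finset.Ico t n, γ j) -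
        2 * δ * k = ν * L ^ 2 * ∑ j ∈ Finset.Ico t n, γ j ^ 2 := by
  induction k generalizing t with
  | zero =>
    obtain rfl : t = n := hkt
    simp
  | succ k ih =>
    have ht : t < n := by omega
    obtain ⟨h_nonneg, h_eq⟩ := ih (t + 1) (by omega)
    have h_rec := hγ t ht
    rw [Finset.sum_eq_sum_Ico_succ_bot ht, Finset.sum_eq_sum_Ico_succ_bot ht]
    set T := ∑ j ∈ Finset.Ico (t + 1) n, γ j
    have h_den : 0 < L * (1 + ν * L * T) := by positivity
    have h_pos : 0 < γ t := h_rec ▸ div_pos hδ h_den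
    rw [eq_div_iff h_den.ne'] at h_rec
    refine ⟨by positivity, ?_⟩
    push_cast
    linear_combination h_eq + 2 * h_rec

/-- For the adaptive step-sizes `γ_t` defined in backward mode by `γ_m = δ/L` and
`γ_t = δ/(L(1 + νL ∑_{j=t+1}^m γ_j))`, setting `Σ := ∑_{t=0}^m γ_t` and
`S² := ∑_{t=0}^m γ_t²`, the identity `νL²Σ² + 2LΣ − 2δ(m+1) = νL²S²` holds. -/
theorem stmt_17 (ν δ L : ℝ) (hν : 0 < ν) (hδ : 0 < δ) (hL : 0 < L)
    (m : ℕ) (hm : 1 ≤ m) (γ : ℕ → ℝ)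
    (hγm : γ m = δ / L)
    (hγt : ∀ t < m, γ t = δ / (L * (1 + ν * L * ∑ j ∈ Finset.Ioc t m, γ j))) :
    ν * L ^ 2 * (∑ t ∈ Finset.range (m + 1), γ t) ^ 2 +
        2 * L * (∑ t ∈ Finset.range (m + 1), γ t) - 2 * δ * (m + 1) =
      ν * L ^ 2 * ∑ t ∈ Finset.range (m + 1), γ t ^ 2 := by
  have hγ : ∀ t < m + 1,
      γ t = δ / (L * (1 + ν * L * ∑ j ∈ Finset.Ico (t + 1) (m + 1), γ j)) := by
    intro t ht
    obtain rfl | h_lt := (Nat.lt_succ_iff.mp ht).eq_or_lt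
    · simpa using hγm
    · have h_Ioc : Finset.Ico (t + 1) (m + 1) = Finset.Ioc t m := by
        ext j
        simp only [Finset.mem_Ico, Finset.mem_Ioc]
        omega
      rw [h_Ioc]
      exact hγt t h_lt
  have h_main := (backward_stepsize_tail_identity hν hδ hL hγ (m + 1) 0 (by omega)).2
  rw [Finset.range_eq_Ico]
  exact_mod_cast h_main
end

section
/- Let E be a real inner product space and let f : E → ℝ be differentiable with L-Lipschitz gradient for some L > 0. Then for any w, v ∈ E and any η̂ > 0, the point w⁺ := w − η̂·v satisfies f(w⁺) ≤ f(w) + (η̂/2)·‖∇f(w) − v‖² − (η̂/2)·(1 − L·η̂)·‖v‖² − (η̂/2)·‖∇f(w)‖². -/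
/-- Quadratic upper bound for a function with `L`-Lipschitz gradient. -/
theorem le_add_inner_gradient_add_of_lipschitz_gradient {E : Type*} [NormedAddCommGroup E]
    [InnerProductSpace ℝ E] [CompleteSpace E] {f : E → ℝ} (hf : Differentiable ℝ f) {L : ℝ}
    (hlip : ∀ x y : E, ‖gradient f x - gradient f y‖ ≤ L * ‖x - y‖) (x d : E) :
    f (x + d) ≤ f x + inner ℝ (gradient f x) d + L / 2 * ‖d‖ ^ 2 := by
  have hline (t : ℝ) : HasDerivAt (fun s : ℝ => f (x + s • d))
      (inner ℝ (gradient f (x + t • d)) d) t := by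
    have hd : HasDerivAt (fun s : ℝ => x + s • d) d t := by
      simpa using ((hasDerivAt_id t).smul_const d).const_add x
    exact (hf (x + t • d)).hasGradientAt.hasFDerivAt.comp_hasDerivAt t hd
  have hderiv (t : ℝ) : HasDerivAt
      (fun s : ℝ => f (x + s • d) - s * inner ℝ (gradient f x) d - s ^ 2 * (L / 2 * ‖d‖ ^ 2))
      (inner ℝ (gradient f (x + t • d) - gradient f x) d - L * t * ‖d‖ ^ 2) t := by
    refine (((hline t).sub ((hasDerivAt_id t).mul_const _)).sub
      ((hasDerivAt_pow 2 t).mul_const _)).congr_deriv ?_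
    rw [inner_sub_left]
    push_cast
    ring
  have hanti := antitoneOn_of_deriv_nonpos (convex_Icc (0 : ℝ) 1)
    (fun t _ => (hderiv t).continuousAt.continuousWithinAt)
    (fun t _ => (hderiv t).differentiableAt.differentiableWithinAt)
    (fun t ht => by
      rw [interior_Icc] at ht
      rw [(hderiv t).deriv, sub_nonpos]
      calc inner ℝ (gradient f (x + t • d) - gradient f x) d
          ≤ ‖gradient f (x + t • d) - gradient f x‖ * ‖d‖ := real_inner_le_norm _ _
        _ ≤ L * ‖x + t • d - x‖ * ‖d‖ := by gcongr; exact hlip _ _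
        _ = L * t * ‖d‖ ^ 2 := by
          rw [add_sub_cancel_left, norm_smul, Real.norm_of_nonneg ht.1.le]
          ring)
  have h := hanti (Set.left_mem_Icc.2 zero_le_one) (Set.right_mem_Icc.2 zero_le_one) zero_le_one
  simp only [one_smul, zero_smul, add_zero] at h
  linarith

/-- One-iteration descent estimate for the non-composite SARAH update
`w⁺ := w − η̂·v`: if `∇f` is `L`-Lipschitz then
`f(w⁺) ≤ f(w) + (η̂/2)‖∇f(w) − v‖² − (η̂/2)(1 − Lη̂)‖v‖² − (η̂/2)‖∇f(w)‖²`. -/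
theorem stmt_18 {E : Type*} [NormedAddCommGroup E] [InnerProductSpace ℝ E]
    [CompleteSpace E] (f : E → ℝ) (hf : Differentiable ℝ f) (L : ℝ) (hL : 0 < L)
    (hlip : ∀ x y : E, ‖gradient f x - gradient f y‖ ≤ L * ‖x - y‖)
    (w v : E) (η : ℝ) (hη : 0 < η) :
    f (w - η • v) ≤
      f w + η / 2 * ‖gradient f w - v‖ ^ 2 -
        η / 2 * (1 - L * η) * ‖v‖ ^ 2 - η / 2 * ‖gradient f w‖ ^ 2 := by
  have h := le_add_inner_gradient_add_of_lipschitz_gradient hf hlip w (-(η • v))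
  rw [← sub_eq_add_neg, inner_neg_right, real_inner_smul_right, norm_neg, norm_smul,
    Real.norm_of_nonneg hη.le] at h
  rw [norm_sub_sq_real]
  linarith
end
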